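/- arXiv:1211.6246 — 2 statements merged into one kernel-verified Lean document; each statement's English description precedes it below -/
import Mathlib

section
/- Let n ≥ 1 and let Λ be a lattice of full rank in ℝ^n with B ≥ 8 n^{n/2} · ν(Λ). Let X = (Λ ∩ [0,B)^n)^n be the set of n-tuples of lattice points in the cube, and let Y = {(y₁,…,y_n) ∈ X : y₁,…,y_n span ℝ^n as a real vector space}. Then |Y| ≥ (1/2)|X|. -/
/-- The covering radius of a lattice: the supremum over `x` of the distance from `x`
to the nearest lattice point. -/
noncomputable def covRad {n : ℕ} (Λ : Submodule ℤ (EuclideanSpace ℝ (Fin n))) : ℝ :=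
  ⨆ x : EuclideanSpace ℝ (Fin n), Metric.infDist x (Λ : Set (EuclideanSpace ℝ (Fin n)))

/-- The half-open cube `[0, B)^n`. -/
def cube (n : ℕ) (B : ℝ) : Set (EuclideanSpace ℝ (Fin n)) :=
  {x | ∀ i, 0 ≤ x i ∧ x i < B}

open MeasureTheory Metric
open scoped ENNReal

section Lattice

variable {n : ℕ} (Λ : Submodule ℤ (EuclideanSpace ℝ (Fin n)))

/-- The closed Voronoi cell of the origin with respect to `Λ`. -/
def voronoiCell : Set (EuclideanSpace ℝ (Fin n)) :=
  {x | ∀ l ∈ Λ, ‖x‖ ≤ ‖x - l‖}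

theorem isClosed_voronoiCell : IsClosed (voronoiCell Λ) := by
  simp only [voronoiCell, Set.ofPred_forall]
  exact isClosed_biInter fun l _ => isClosed_le (by fun_prop) (by fun_prop)

theorem card_mul_volume_voronoiCell_le (T : Finset (EuclideanSpace ℝ (Fin n)))
    (hT : ∀ l ∈ T, l ∈ Λ) (D : Set (EuclideanSpace ℝ (Fin n)))
    (hD : ∀ l ∈ T, ∀ y ∈ voronoiCell Λ, l + y ∈ D) :
    T.card * volume (voronoiCell Λ) ≤ volume D := by
  have hmeas (l : EuclideanSpace ℝ (Fin n)) : MeasurableSet ((fun x => x - l) ⁻¹' voronoiCell Λ) :=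
    ((isClosed_voronoiCell Λ).preimage (by fun_prop)).measurableSet
  calc _ = ∑ l ∈ T, volume ((fun x => x - l) ⁻¹' voronoiCell Λ) := by
        simp [sub_eq_add_neg, measure_preimage_add_right]
    _ = volume (⋃ l ∈ T, (fun x => x - l) ⁻¹' voronoiCell Λ) := by
        refine (measure_biUnion_finset₀ (fun l hl m hm hlm => ?_)
          fun l _ => (hmeas l).nullMeasurableSet).symm
        refine measure_mono_null (t := (AffineSubspace.perpBisector l m : Set _)) ?_
          (Measure.addHaar_affineSubspace _ _ (by simpa using hlm))
        rintro x ⟨hx, hy⟩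
        rw [SetLike.mem_coe, AffineSubspace.mem_perpBisector_iff_dist_eq, dist_eq_norm,
          dist_eq_norm]
        refine le_antisymm ?_ ?_
        · simpa using hx (m - l) (Λ.sub_mem (hT m hm) (hT l hl))
        · simpa using hy (l - m) (Λ.sub_mem (hT l hl) (hT m hm))
    _ ≤ _ := by
        refine measure_mono fun x hx => ?_
        simp only [Set.mem_iUnion] at hx
        obtain ⟨l, hl, hx⟩ := hx
        simpa using hD l hl _ hx

variable [DiscreteTopology Λ]

theorem isClosed_coe_of_discrete : IsClosed (Λ : Set (EuclideanSpace ℝ (Fin n))) := by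
  have : DiscreteTopology Λ.toAddSubgroup := inferInstanceAs (DiscreteTopology Λ)
  exact AddSubgroup.isClosed_of_discrete (H := Λ.toAddSubgroup)

theorem isBounded_cube (B : ℝ) : Bornology.IsBounded (cube n B) := by
  have h : cube n B ⊆ WithLp.ofLp ⁻¹' Set.Icc (0 : Fin n → ℝ) (fun _ => B) := fun x hx =>
    ⟨fun i => (hx i).1, fun i => (hx i).2.le⟩
  exact ((PiLp.antilipschitzWith_ofLp 2 _).isBounded_preimage (Metric.isBounded_Icc _ _)).subset h

theorem finite_inter_cube (B : ℝ) :
    ((Λ : Set (EuclideanSpace ℝ (Fin n))) ∩ cube n B).Finite := by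
  rw [Set.inter_comm]
  exact finite_isBounded_inter_isClosed DiscreteTopology.isDiscrete (isBounded_cube B)
    (isClosed_coe_of_discrete Λ)

variable [IsZLattice ℝ Λ]

theorem infDist_le_covRad (x : EuclideanSpace ℝ (Fin n)) :
    infDist x (Λ : Set (EuclideanSpace ℝ (Fin n))) ≤ covRad Λ := by
  let b := (Module.Free.chooseBasis ℤ Λ).ofZLatticeBasis ℝ Λ
  refine le_ciSup (f := fun x => infDist x (Λ : Set (EuclideanSpace ℝ (Fin n))))
    ⟨∑ i, ‖b i‖, ?_⟩ x
  rintro _ ⟨y, rfl⟩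
  have hmem : (ZSpan.floor b y : EuclideanSpace ℝ (Fin n)) ∈ Λ :=
    ((Module.Free.chooseBasis ℤ Λ).ofZLatticeBasis_span ℝ Λ).le (ZSpan.floor b y).2
  refine (infDist_le_dist_of_mem hmem).trans ?_
  rw [dist_eq_norm]
  exact ZSpan.norm_fract_le b y

theorem exists_nearest_lattice_point (x : EuclideanSpace ℝ (Fin n)) :
    ∃ l ∈ Λ, x - l ∈ voronoiCell Λ ∧ ‖x - l‖ ≤ covRad Λ := by
  obtain ⟨l, hl, h⟩ := (isClosed_coe_of_discrete Λ).exists_infDist_eq_dist ⟨0, Λ.zero_mem⟩ x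
  refine ⟨l, hl, fun m hm => ?_, ?_⟩
  · rw [← dist_eq_norm, ← h, sub_sub, ← dist_eq_norm]
    exact infDist_le_dist_of_mem (Λ.add_mem hl hm)
  · rw [← dist_eq_norm, ← h]
    exact infDist_le_covRad Λ x

theorem voronoiCell_subset_closedBall : voronoiCell Λ ⊆ closedBall 0 (covRad Λ) := by
  intro x hx
  obtain ⟨l, hl, -, h⟩ := exists_nearest_lattice_point Λ x
  simpa using (hx l hl).trans h

theorem volume_voronoiCell_ne_top : volume (voronoiCell Λ) ≠ ∞ :=
  ((measure_mono (voronoiCell_subset_closedBall Λ)).trans_lt measure_closedBall_lt_top).ne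

theorem volume_le_ncard_mul_volume_voronoiCell (B : ℝ) :
    ENNReal.ofReal (B - 2 * covRad Λ) ^ n ≤
      ((Λ : Set (EuclideanSpace ℝ (Fin n))) ∩ cube n B).ncard * volume (voronoiCell Λ) := by
  set ν := covRad Λ
  have hfin := finite_inter_cube Λ B
  have hbox : volume (WithLp.ofLp ⁻¹' Set.pi Set.univ (fun _ : Fin n => Set.Ico ν (B - ν)) :
      Set (EuclideanSpace ℝ (Fin n))) = ENNReal.ofReal (B - 2 * ν) ^ n := by
    rw [(PiLp.volume_preserving_ofLp (Fin n)).measure_preimage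
      (MeasurableSet.univ_pi fun _ => measurableSet_Ico).nullMeasurableSet, volume_pi_pi]
    simp only [Real.volume_Ico, Finset.prod_const, Finset.card_univ, Fintype.card_fin]
    congr 2; ring
  rw [← hbox, Set.ncard_eq_toFinset_card _ hfin]
  calc _ ≤ volume (⋃ l ∈ hfin.toFinset, (fun x => x - l) ⁻¹' voronoiCell Λ) := by
        refine measure_mono fun x hx => ?_
        obtain ⟨l, hl, hV, hd⟩ := exists_nearest_lattice_point Λ x
        simp only [Set.mem_iUnion]
        refine ⟨l, ?_, hV⟩
        rw [Set.Finite.mem_toFinset]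
        refine ⟨hl, fun i => ?_⟩
        have h1 := abs_le.1 ((PiLp.norm_apply_le (x - l) i).trans hd)
        have h2 := hx i (Set.mem_univ i)
        simp only [PiLp.sub_apply, Set.mem_Ico] at h1 h2
        constructor <;> linarith
    _ ≤ ∑ l ∈ hfin.toFinset, volume ((fun x => x - l) ⁻¹' voronoiCell Λ) :=
        measure_biUnion_finset_le _ _
    _ = _ := by simp [sub_eq_add_neg, measure_preimage_add_right]

theorem covRad_pos (hn : 1 ≤ n) : 0 < covRad Λ := by
  have h0 : 0 ≤ covRad Λ := infDist_nonneg.trans (infDist_le_covRad Λ 0)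
  refine h0.lt_of_ne fun h => ?_
  have hV : volume (voronoiCell Λ) = 0 := by
    have : Nonempty (Fin n) := ⟨⟨0, hn⟩⟩
    refine measure_mono_null (voronoiCell_subset_closedBall Λ) ?_
    rw [← h, closedBall_zero]
    exact measure_singleton _
  have := volume_le_ncard_mul_volume_voronoiCell Λ 1
  rw [← h, hV] at this
  simp at this

end Lattice

theorem volume_slab {n : ℕ} (u : EuclideanSpace ℝ (Fin n)) (i : Fin n) (hu : u i ≠ 0)
    (a c d : ℝ) :
    volume {x : EuclideanSpace ℝ (Fin n) | |inner ℝ u x| ≤ a ∧ ∀ j ≠ i, x j ∈ Set.Icc c d} =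
      ENNReal.ofReal |(u i)⁻¹| * (ENNReal.ofReal (2 * a) * ENNReal.ofReal (d - c) ^ (n - 1)) := by
  let A : Matrix (Fin n) (Fin n) ℝ := Matrix.updateRow 1 i (WithLp.ofLp u)
  have hdet : LinearMap.det (Matrix.toLin' A) = u i := by
    rw [LinearMap.det_toLin', ← Matrix.cramer_transpose_apply]
    simp
  let S : Fin n → Set ℝ := Function.update (fun _ => Set.Icc c d) i (Set.Icc (-a) a)
  have hset : {x : EuclideanSpace ℝ (Fin n) | |inner ℝ u x| ≤ a ∧ ∀ j ≠ i, x j ∈ Set.Icc c d} =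
      WithLp.ofLp ⁻¹' (Matrix.toLin' A ⁻¹' Set.pi Set.univ S) := by
    ext x
    have hi : (A.mulVec (WithLp.ofLp x)) i = inner ℝ u x := by
      simp [A, Matrix.mulVec, PiLp.inner_apply, dotProduct, mul_comm]
    have hj : ∀ j ≠ i, (A.mulVec (WithLp.ofLp x)) j = x j := by
      intro j hj
      simp [A, Matrix.mulVec, Matrix.updateRow_ne hj, Matrix.one_apply, dotProduct]
    simp only [Set.mem_ofPred_eq, Set.mem_preimage, Set.mem_pi, Set.mem_univ, true_imp_iff,
      Matrix.toLin'_apply]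
    constructor
    · rintro ⟨h1, h2⟩ j
      by_cases h : j = i
      · subst h
        rw [hi]
        simpa [S] using abs_le.1 h1
      · rw [hj j h]
        simpa [S, h] using h2 j h
    · intro h
      refine ⟨abs_le.2 ?_, fun j hne => ?_⟩
      · simpa [S, hi] using h i
      · simpa [S, hne, hj j hne] using h j
  have hS : MeasurableSet (Set.pi Set.univ S) := by
    refine MeasurableSet.univ_pi fun j => ?_
    by_cases h : j = i
    · subst h; simp [S]
    · simp [S, h]
  rw [hset, (PiLp.volume_preserving_ofLp (Fin n)).measure_preimage
      ((LinearMap.continuous_of_finiteDimensional _).measurable hS).nullMeasurableSet,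
    Measure.addHaar_preimage_linearMap _ (by rwa [hdet]), hdet,
    volume_pi_pi, ← Finset.mul_prod_erase Finset.univ _ (Finset.mem_univ i)]
  congr 2
  · simp only [S, Function.update_self, Real.volume_Icc]
    congr 1; ring
  · rw [Finset.prod_congr rfl (g := fun _ => ENNReal.ofReal (d - c))]
    · simp
    · intro j hj
      simp [S, Finset.ne_of_mem_erase hj]

theorem exists_one_le_mul_sq {n : ℕ} (u : EuclideanSpace ℝ (Fin n)) (hu : ‖u‖ = 1) :
    ∃ i, 1 ≤ n * u i ^ 2 := by
  by_contra! h
  have h1 : ∑ i, u i ^ 2 = 1 := by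
    have := EuclideanSpace.real_norm_sq_eq u
    rw [← this, hu, one_pow]
  rcases Nat.eq_zero_or_pos n with rfl | hn
  · simp at h1
  have h2 : ∑ i : Fin n, n * u i ^ 2 < ∑ i : Fin n, (1 : ℝ) :=
    Finset.sum_lt_sum_of_nonempty ⟨⟨0, hn⟩, Finset.mem_univ _⟩ fun i _ => h i
  rw [← Finset.mul_sum, h1] at h2
  simp at h2

theorem exists_unit_normal {n : ℕ} (W : Submodule ℝ (EuclideanSpace ℝ (Fin n))) (hW : W ≠ ⊤) :
    ∃ u : EuclideanSpace ℝ (Fin n), ‖u‖ = 1 ∧ ∀ x ∈ W, inner ℝ u x = 0 := by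
  have : Wᗮ ≠ ⊥ := fun h => hW ((Submodule.orthogonal_eq_bot_iff).1 h)
  obtain ⟨w, hw, h0⟩ := Submodule.exists_mem_ne_zero_of_ne_bot this
  refine ⟨(‖w‖⁻¹ : ℝ) • w, norm_smul_inv_norm h0, fun x hx => ?_⟩
  rw [real_inner_smul_left, Submodule.inner_left_of_mem_orthogonal hx hw, mul_zero]

open Classical in
/-- If every proper subspace contains at most `M` points of `T`, few tuples from `T` are linearly
dependent. -/
theorem card_not_linearIndependent_le {V : Type*} [AddCommGroup V] [Module ℝ V]
    [FiniteDimensional ℝ V] (T : Finset V) (M : ℕ)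
    (hM : ∀ W : Submodule ℝ V, W ≠ ⊤ → (T.filter (· ∈ W)).card ≤ M)
    (k : ℕ) (hk : k + 1 ≤ Module.finrank ℝ V) :
    ((Fintype.piFinset fun _ : Fin (k + 1) => T).filter
      fun v => ¬ LinearIndependent ℝ v).card ≤ (1 + k * M) * T.card ^ k := by
  induction k with
  | zero =>
    simp only [zero_mul, add_zero, pow_zero, mul_one, Finset.card_le_one]
    intro v hv w hw
    have key : ∀ v ∈ ((Fintype.piFinset fun _ : Fin (0 + 1) => T).filter
        fun v => ¬ LinearIndependent ℝ v), v = 0 := by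
      intro v hv
      have := (Finset.mem_filter.1 hv).2
      rw [linearIndependent_unique_iff (ι := Fin 1), not_not] at this
      funext j
      rw [Subsingleton.elim (α := Fin 1) j default, this]
      rfl
    rw [key v hv, key w hw]
  | succ k ih =>
    have ih := ih (by lia)
    let P := Fintype.piFinset fun _ : Fin (k + 1 + 1) => T
    let Q := Fintype.piFinset fun _ : Fin (k + 1) => T
    have hinit : ∀ v ∈ P, Fin.init v ∈ Q := fun v hv =>
      Fintype.mem_piFinset.2 fun j => Fintype.mem_piFinset.1 hv _
    have hsub : (P.filter fun v => ¬ LinearIndependent ℝ v) ⊆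
        (P.filter fun v => ¬ LinearIndependent ℝ (Fin.init v : Fin (k + 1) → V)) ∪
        (P.filter fun v : Fin (k + 1 + 1) → V => v (Fin.last (k + 1)) ∈
          Submodule.span ℝ (Set.range (Fin.init v : Fin (k + 1) → V))) := by
      intro v hv
      obtain ⟨hv, hd⟩ := Finset.mem_filter.1 hv
      rw [← Fin.snoc_init_self v, linearIndependent_finSnoc] at hd
      rw [Finset.mem_union, Finset.mem_filter, Finset.mem_filter]
      tauto
    have fiber : ∀ (R : Finset (Fin (k + 1 + 1) → V)) (A : Finset V) (w : Fin (k + 1) → V),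
        (∀ v ∈ R, Fin.init v = w → v (Fin.last _) ∈ A) →
        (R.filter fun v => (Fin.init v : Fin (k + 1) → V) = w).card ≤ A.card := by
      intro R A w h
      refine Finset.card_le_card_of_injOn (fun v => v (Fin.last _)) ?_ ?_
      · intro v hv
        obtain ⟨h1, h2⟩ := Finset.mem_filter.1 hv
        exact h v h1 h2
      · intro v hv v' hv' he
        rw [← Fin.snoc_init_self v, ← Fin.snoc_init_self v', (Finset.mem_filter.1 hv).2,
          (Finset.mem_filter.1 hv').2]
        simp only at he
        rw [he]
    have h1 : (P.filter fun v => ¬ LinearIndependent ℝ (Fin.init v : Fin (k + 1) → V)).card ≤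
        T.card * (Q.filter fun v => ¬ LinearIndependent ℝ v).card := by
      refine Finset.card_le_mul_card_image_of_maps_to (f := Fin.init) ?_ _ ?_
      · intro v hv
        obtain ⟨h1, h2⟩ := Finset.mem_filter.1 hv
        exact Finset.mem_filter.2 ⟨hinit v h1, h2⟩
      · intro w _
        exact fiber _ _ _ fun v hv _ => Fintype.mem_piFinset.1 (Finset.mem_filter.1 hv).1 _
    have h2 : (P.filter fun v : Fin (k + 1 + 1) → V => v (Fin.last (k + 1)) ∈
        Submodule.span ℝ (Set.range (Fin.init v : Fin (k + 1) → V))).card ≤ M * Q.card := by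
      refine Finset.card_le_mul_card_image_of_maps_to (f := Fin.init) ?_ _ ?_
      · intro v hv
        exact hinit v (Finset.mem_filter.1 hv).1
      · intro w _
        refine (fiber _ (T.filter (· ∈ Submodule.span ℝ (Set.range w))) w ?_).trans (hM _ ?_)
        · rintro v hv rfl
          obtain ⟨h1, h2⟩ := Finset.mem_filter.1 hv
          exact Finset.mem_filter.2 ⟨Fintype.mem_piFinset.1 h1 _, h2⟩
        · intro htop
          have := finrank_range_le_card (R := ℝ) w
          rw [Set.finrank, htop, finrank_top, Fintype.card_fin] at this
          lia
    have hQ : Q.card = T.card ^ (k + 1) := by simp [Q]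
    calc _ ≤ _ := (Finset.card_le_card hsub).trans (Finset.card_union_le _ _)
      _ ≤ T.card * ((1 + k * M) * T.card ^ k) + M * T.card ^ (k + 1) := by
        rw [hQ] at h2
        exact add_le_add (h1.trans (Nat.mul_le_mul_left _ ih)) h2
      _ = _ := by ring

theorem add_pow_mul_le_sub_pow {n : ℕ} (hn : 1 ≤ n) {B t : ℝ} (ht : 0 < t) (hB : t ≤ B) :
    (B + t) ^ (n - 1) * (B + t - 2 * n * t) ≤ (B - t) ^ n := by
  have hp : 0 < B + t := by linarith
  have h := one_add_mul_le_pow (a := -(2 * t) / (B + t))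
    (by rw [le_div_iff₀ hp]; linarith) n
  have h1 : B - t = (B + t) * (1 + -(2 * t) / (B + t)) := by field_simp; ring
  have h2 : B + t - 2 * n * t = (B + t) * (1 + n * (-(2 * t) / (B + t))) := by field_simp; ring
  rw [h1, mul_pow, h2, ← mul_assoc, ← pow_succ, Nat.sub_add_cancel hn]
  gcongr

open Classical in
/-- A proper subspace contains only a small fraction of the lattice points in a large cube. -/
theorem card_filter_mem_mul_le {n : ℕ} (hn : 1 ≤ n)
    (Λ : Submodule ℤ (EuclideanSpace ℝ (Fin n))) [DiscreteTopology Λ] [IsZLattice ℝ Λ]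
    {B : ℝ} (hB : 2 * covRad Λ < B) (hB' : 4 * n * covRad Λ ≤ B + 2 * covRad Λ)
    (W : Submodule ℝ (EuclideanSpace ℝ (Fin n))) (hW : W ≠ ⊤) :
    (((finite_inter_cube Λ B).toFinset.filter (· ∈ W)).card : ℝ) *
        (B + 2 * covRad Λ - 4 * n * covRad Λ) ≤
      (finite_inter_cube Λ B).toFinset.card * (2 * covRad Λ * √n) := by
  have hν := covRad_pos Λ hn
  have hcover := volume_le_ncard_mul_volume_voronoiCell Λ B
  have hV := volume_voronoiCell_ne_top Λ
  rw [Set.ncard_eq_toFinset_card _ (finite_inter_cube Λ B)] at hcover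
  set T := (finite_inter_cube Λ B).toFinset
  set ν := covRad Λ
  obtain ⟨u, hu, huW⟩ := exists_unit_normal W hW
  obtain ⟨i, hi⟩ := exists_one_le_mul_sq u hu
  have hui : u i ≠ 0 := by
    intro h
    norm_num [h] at hi
  have hpack := card_mul_volume_voronoiCell_le Λ (T.filter (· ∈ W))
    (fun l hl => ((Set.Finite.mem_toFinset _).1 (Finset.mem_filter.1 hl).1).1)
    {x | |inner ℝ u x| ≤ ν ∧ ∀ j ≠ i, x j ∈ Set.Icc (-ν) (B + ν)} (by
      intro l hl y hy
      obtain ⟨hl, hlW⟩ := Finset.mem_filter.1 hl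
      have hl := ((Set.Finite.mem_toFinset _).1 hl).2
      have hy : ‖y‖ ≤ ν := by simpa using voronoiCell_subset_closedBall Λ hy
      refine ⟨?_, fun j _ => ?_⟩
      · rw [inner_add_right, huW l hlW, zero_add]
        exact (abs_real_inner_le_norm u y).trans (by rw [hu, one_mul]; exact hy)
      · have h1 := abs_le.1 ((PiLp.norm_apply_le y j).trans hy)
        have h2 := hl j
        simp only [PiLp.add_apply, Set.mem_Icc]
        constructor <;> linarith)
  rw [volume_slab u i hui] at hpack
  set c := (volume (voronoiCell Λ)).toReal
  have hcover : (B - 2 * ν) ^ n ≤ T.card * c := by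
    have := ENNReal.toReal_mono (ENNReal.mul_ne_top (by simp) hV) hcover
    simpa [ENNReal.toReal_ofReal (show 0 ≤ B - 2 * ν by linarith)] using this
  have hpack : (T.filter (· ∈ W)).card * c ≤ |(u i)⁻¹| * (2 * ν * (B + 2 * ν) ^ (n - 1)) := by
    have := ENNReal.toReal_mono (by finiteness) hpack
    rw [show B + ν - -ν = B + 2 * ν by ring] at this
    simpa [ENNReal.toReal_ofReal (show 0 ≤ B + 2 * ν by linarith),
      ENNReal.toReal_ofReal hν.le] using this
  have hinv : |(u i)⁻¹| ≤ √n := by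
    rw [abs_inv]
    have h0 : 0 < |u i| := abs_pos.2 hui
    rw [inv_le_iff_one_le_mul₀ h0]
    refine (one_le_sq_iff₀ (by positivity)).1 ?_
    rwa [mul_pow, Real.sq_sqrt (by positivity), sq_abs]
  have hpos : 0 < (B - 2 * ν) ^ n := pow_pos (by linarith) n
  have hbern := add_pow_mul_le_sub_pow hn (B := B) (t := 2 * ν) (by linarith) hB.le
  have hP : 0 < (B + 2 * ν) ^ (n - 1) := pow_pos (by linarith) _
  set P := (B + 2 * ν) ^ (n - 1)
  have hc : 0 < c := pos_of_mul_pos_right (hpos.trans_le hcover) (by positivity)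
  set Q := B + 2 * ν - 4 * n * ν with hQ
  have hQ0 : 0 ≤ Q := by linarith
  rw [show B + 2 * ν - 2 * n * (2 * ν) = Q by rw [hQ]; ring] at hbern
  refine le_of_mul_le_mul_right ?_ (mul_pos hP hc)
  calc ((T.filter (· ∈ W)).card : ℝ) * Q * (P * c)
      = ((T.filter (· ∈ W)).card * c) * (P * Q) := by ring
    _ ≤ (√n * (2 * ν * P)) * (T.card * c) := by
        refine mul_le_mul (hpack.trans ?_) (hbern.trans hcover) (by positivity) (by positivity)
        gcongr
    _ = _ := by ring

theorem two_mul_add_le_of_mul_le {n : ℕ} (hn : 1 ≤ n) {B ν : ℝ} (hν : 0 < ν)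
    (hB : B ≥ 8 * (n : ℝ) ^ ((n : ℝ) / 2) * ν) {M N : ℕ} (hM : 1 ≤ M)
    (h : M * (B + 2 * ν - 4 * n * ν) ≤ N * (2 * ν * √n)) :
    2 * (1 + (n - 1) * M) ≤ N := by
  obtain rfl | rfl | hn3 : n = 1 ∨ n = 2 ∨ 3 ≤ n := by lia
  · norm_num at hB h
    have h1 : (M : ℝ) * 3 ≤ N := by
      refine le_of_mul_le_mul_right ?_ (show 0 < 2 * ν by linarith)
      have : (M : ℝ) * (6 * ν) ≤ M * (B + 2 * ν - 4 * ν) := by gcongr; linarith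
      linarith
    have : M * 3 ≤ N := by exact_mod_cast h1
    lia
  · norm_num at hB h
    have hs : √(2 : ℝ) ≤ 10 / 7 := Real.sqrt_le_iff.2 (by norm_num)
    have h1 : (M : ℝ) * 7 ≤ 2 * N := by
      refine le_of_mul_le_mul_right ?_ (show 0 < 10 * ν by linarith)
      have h2 : (M : ℝ) * (10 * ν) ≤ M * (B + 2 * ν - 8 * ν) := by gcongr; linarith
      have h3 : (N : ℝ) * (2 * ν * √2) ≤ N * (2 * ν * (10 / 7)) := by gcongr
      linarith
    have : M * 7 ≤ 2 * N := by exact_mod_cast h1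
    lia
  · have hn1 : (1 : ℝ) ≤ n := by exact_mod_cast hn
    have hn3' : (3 : ℝ) ≤ n := by exact_mod_cast hn3
    have hs : 1 ≤ √(n : ℝ) := Real.one_le_sqrt.2 hn1
    have hpow : n * √n ≤ (n : ℝ) ^ ((n : ℝ) / 2) := by
      calc n * √n = (n : ℝ) ^ ((3 : ℝ) / 2) := by
            rw [show (3 : ℝ) / 2 = 1 + 1 / 2 by norm_num, Real.rpow_add (by linarith),
              Real.rpow_one, Real.sqrt_eq_rpow]
        _ ≤ _ := Real.rpow_le_rpow_of_exponent_le hn1 (by linarith)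
    have hQ : 4 * n * √n * ν ≤ B + 2 * ν - 4 * n * ν := by
      have h1 : 8 * (n * √n) * ν ≤ B := le_trans (by gcongr) hB
      have h2 : 4 * n * 1 * ν ≤ 4 * n * √n * ν := by gcongr
      linarith
    have h1 : (M : ℝ) * (2 * n) ≤ N := by
      refine le_of_mul_le_mul_right ?_ (show 0 < 2 * ν * √n by positivity)
      calc _ = M * (4 * n * √n * ν) := by ring
        _ ≤ M * (B + 2 * ν - 4 * n * ν) := by gcongr
        _ ≤ _ := h
    have h2 : M * (2 * n) ≤ N := by exact_mod_cast h1
    obtain ⟨m, rfl⟩ : ∃ m, n = m + 1 := ⟨n - 1, by lia⟩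
    rw [Nat.add_sub_cancel]
    nlinarith

theorem four_mul_lt_and_two_mul_lt {n : ℕ} (hn : 1 ≤ n) {B ν : ℝ} (hν : 0 < ν)
    (hB : B ≥ 8 * (n : ℝ) ^ ((n : ℝ) / 2) * ν) : 4 * n * ν < B + 2 * ν ∧ 2 * ν < B := by
  have hn1 : (1 : ℝ) ≤ n := by exact_mod_cast hn
  have h1 : (1 : ℝ) ≤ (n : ℝ) ^ ((n : ℝ) / 2) := Real.one_le_rpow hn1 (by positivity)
  have h2 : (8 : ℝ) * 1 * ν ≤ 8 * (n : ℝ) ^ ((n : ℝ) / 2) * ν := by gcongr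
  refine ⟨?_, by linarith⟩
  obtain rfl | hn2 : n = 1 ∨ 2 ≤ n := by lia
  · norm_num at h2 hB ⊢
    linarith
  · have hn2' : (2 : ℝ) ≤ n := by exact_mod_cast hn2
    have h3 : (n : ℝ) ≤ (n : ℝ) ^ ((n : ℝ) / 2) := by
      conv_lhs => rw [← Real.rpow_one (n : ℝ)]
      exact Real.rpow_le_rpow_of_exponent_le hn1 (by linarith)
    have h4 : 8 * n * ν ≤ 8 * (n : ℝ) ^ ((n : ℝ) / 2) * ν := by gcongr
    have h5 : 0 < n * ν := by positivity
    linarith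

theorem prob_full_rank_sublattice (n : ℕ) (hn : 1 ≤ n)
    (Λ : Submodule ℤ (EuclideanSpace ℝ (Fin n)))
    [DiscreteTopology Λ] [IsZLattice ℝ Λ] (B : ℝ)
    (hB : B ≥ 8 * (n : ℝ) ^ ((n : ℝ) / 2) * covRad Λ)
    (X : Set (Fin n → EuclideanSpace ℝ (Fin n)))
    (hX : X = {v | ∀ i, v i ∈ (Λ : Set (EuclideanSpace ℝ (Fin n))) ∩ cube n B})
    (Y : Set (Fin n → EuclideanSpace ℝ (Fin n)))
    (hY : Y = {v ∈ X | Submodule.span ℝ (Set.range v) = ⊤}) :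
    (Y.ncard : ℝ) ≥ (1 / 2) * X.ncard := by
  classical
  have hν := covRad_pos Λ hn
  obtain ⟨hB4, hB2⟩ := four_mul_lt_and_two_mul_lt hn hν hB
  have hW := card_filter_mem_mul_le hn Λ hB2 hB4.le
  set T := (finite_inter_cube Λ B).toFinset with hT
  set ν := covRad Λ
  have hQ : 0 < B + 2 * ν - 4 * n * ν := by linarith
  let M := ⌊T.card * (2 * ν * √n) / (B + 2 * ν - 4 * n * ν)⌋₊
  have hWM (W : Submodule ℝ (EuclideanSpace ℝ (Fin n))) (h : W ≠ ⊤) :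
      (T.filter (· ∈ W)).card ≤ M := Nat.le_floor ((le_div_iff₀ hQ).2 (hW W h))
  have hM1 : 1 ≤ M := by
    have : Nonempty (Fin n) := ⟨⟨0, hn⟩⟩
    refine le_trans ?_ (hWM ⊥ bot_ne_top)
    refine Finset.card_pos.2 ⟨0, Finset.mem_filter.2 ⟨?_, Submodule.zero_mem _⟩⟩
    exact (Set.Finite.mem_toFinset _).2 ⟨Λ.zero_mem, fun i => ⟨le_rfl, by simp; linarith⟩⟩
  have hMN : 2 * (1 + (n - 1) * M) ≤ T.card :=
    two_mul_add_le_of_mul_le hn hν hB hM1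
      ((le_div_iff₀ hQ).1 (Nat.floor_le (by positivity)))
  have hbad := card_not_linearIndependent_le T M hWM (n - 1)
    (by rw [finrank_euclideanSpace_fin]; lia)
  rw [Nat.sub_add_cancel hn] at hbad
  let P := Fintype.piFinset fun _ : Fin n => T
  have hXP : X = P := by
    ext v
    simp [hX, P, hT]
  have hYP : Y = (P.filter fun v => LinearIndependent ℝ v : Finset _) := by
    ext v
    rw [hY, hXP, Finset.coe_filter]
    refine and_congr_right fun _ => ⟨fun h => ?_, fun h => ?_⟩
    · exact linearIndependent_of_top_le_span_of_card_eq_finrank h.ge (by simp)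
    · exact h.span_eq_top_of_card_eq_finrank' (by simp)
  rw [hYP, hXP, Set.ncard_coe_finset, Set.ncard_coe_finset]
  have hsplit := P.card_filter_add_card_filter_not (fun v => LinearIndependent ℝ v)
  have hP : P.card = T.card ^ (n - 1) * T.card := by
    rw [← pow_succ, Nat.sub_add_cancel hn]
    simp [P]
  have h2 := Nat.mul_le_mul_left (T.card ^ (n - 1)) hMN
  have h3 : P.card ≤ 2 * (P.filter fun v => LinearIndependent ℝ v).card := by
    change (P.filter fun v => ¬ LinearIndependent ℝ v).card ≤ _ at hbad
    rw [← hP] at h2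
    linarith
  have h4 : (P.card : ℝ) ≤ 2 * (P.filter fun v => LinearIndependent ℝ v).card := by
    exact_mod_cast h3
  linarith
end

section
/- Let G be a finite abelian group that can be generated by n elements. Then the number of (n+1)-tuples (g₁,…,g_{n+1}) ∈ G^{n+1} with ⟨g₁,…,g_{n+1}⟩ = G is at least (∏_{i=2}^{n+1} ζ(i)^{-1}) · |G|^{n+1}, and in particular at least 0.434 · |G|^{n+1}. -/
/-- The real Riemann zeta value `ζ(i) = ∑_{k=1}^∞ k^{-i}`. -/
noncomputable def zetaR (i : ℕ) : ℝ := ∑' k : ℕ, 1 / (k + 1 : ℝ) ^ i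

lemma summable_one_div_add_one_pow {i : ℕ} (hi : 2 ≤ i) :
    Summable fun k : ℕ => 1 / (k + 1 : ℝ) ^ i := by
  have := (summable_nat_add_iff 1).2 (Real.summable_one_div_nat_pow.2 (show 1 < i by omega))
  simpa using this

lemma one_le_zetaR {i : ℕ} (hi : 2 ≤ i) : 1 ≤ zetaR i := by
  have := (summable_one_div_add_one_pow hi).le_tsum 0 fun k _ => by positivity
  simpa [zetaR] using this

lemma zetaR_two : zetaR 2 = Real.pi ^ 2 / 6 := by
  have h := (hasSum_nat_add_iff' 1).2 hasSum_zeta_two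
  simpa [zetaR] using h.tsum_eq

/-- Truncation bound: the tail of `ζ(j + 2)` is controlled by the tail of `ζ(2)`. -/
lemma zetaR_le (N j : ℕ) : zetaR (j + 2) ≤ ∑ k ∈ Finset.range N, 1 / (k + 1 : ℝ) ^ (j + 2) +
    1 / (N + 1 : ℝ) ^ j * (Real.pi ^ 2 / 6 - ∑ k ∈ Finset.range N, 1 / (k + 1 : ℝ) ^ 2) := by
  have h2 := summable_one_div_add_one_pow (le_refl 2)
  have hj := summable_one_div_add_one_pow (show 2 ≤ j + 2 by omega)
  have e2 : ∑' k : ℕ, 1 / ((k + N : ℕ) + 1 : ℝ) ^ 2 =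
      Real.pi ^ 2 / 6 - ∑ k ∈ Finset.range N, 1 / (k + 1 : ℝ) ^ 2 := by
    rw [← zetaR_two, zetaR, ← h2.sum_add_tsum_nat_add N]
    ring
  rw [← e2, zetaR, ← hj.sum_add_tsum_nat_add N, ← tsum_mul_left]
  refine add_le_add_right (Summable.tsum_le_tsum (fun k => ?_) ((summable_nat_add_iff N).2 hj)
    (((summable_nat_add_iff N).2 h2).mul_left _)) _
  have hle : (N + 1 : ℝ) ^ j ≤ ((k + N : ℕ) + 1 : ℝ) ^ j := by
    gcongr
    omega
  rw [div_mul_div_comm, one_mul, pow_add]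
  gcongr

lemma pi_sq_div_six_lt : Real.pi ^ 2 / 6 < 1.64494 := by
  have h1 := Real.pi_lt_d6
  have h0 := Real.pi_pos
  nlinarith

/-- A finite part of the Euler product of `ζ(i)⁻¹` is at least `ζ(i)⁻¹`. -/
lemma inv_zetaR_le_prod {i : ℕ} (hi : 2 ≤ i) {S : Finset ℕ} (hS : ∀ p ∈ S, p.Prime) :
    (zetaR i)⁻¹ ≤ ∏ p ∈ S, (1 - ((p : ℝ) ^ i)⁻¹) := by
  let f : ℕ →*₀ ℝ :=
    { toFun := fun m => ((m : ℝ) ^ i)⁻¹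
      map_zero' := by simp [show i ≠ 0 by omega]
      map_one' := by simp
      map_mul' := fun a b => by simp [mul_pow, mul_comm] }
  have hf : ∀ {p : ℕ}, p.Prime → ‖f p‖ < 1 := by
    intro p hp
    have h1 : (1 : ℝ) < p := mod_cast hp.one_lt
    change ‖((p : ℝ) ^ i)⁻¹‖ < 1
    rw [Real.norm_of_nonneg (by positivity)]
    exact inv_lt_one_of_one_lt₀ (one_lt_pow₀ h1 (by omega))
  have hfs : Summable f := by
    have := Real.summable_one_div_nat_pow.2 (show 1 < i by omega)
    simpa [f] using this
  have hz : zetaR i = ∑' m, f m := by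
    rw [hfs.tsum_eq_zero_add, map_zero, zero_add, zetaR]
    simp [f]
  obtain ⟨-, hsum⟩ :=
    EulerProduct.summable_and_hasSum_factoredNumbers_prod_filter_prime_geometric
      (f := (f : ℕ →* ℝ)) hf S
  rw [Finset.filter_true_of_mem hS] at hsum
  have hle : ∏ p ∈ S, (1 - f p)⁻¹ ≤ zetaR i := by
    rw [hz]
    refine hsum.tsum_eq.symm.trans_le ?_
    exact hfs.tsum_subtype_le _ _ fun m => inv_nonneg.2 (pow_nonneg m.cast_nonneg i)
  rw [Finset.prod_inv_distrib] at hle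
  have hpos : 0 < ∏ p ∈ S, (1 - f p) := Finset.prod_pos fun p hp => by
    have := hf (hS p hp)
    rw [Real.norm_eq_abs] at this
    linarith [(abs_lt.1 this).2]
  exact inv_le_of_inv_le₀ hpos hle

lemma prod_zetaR_eleven_lt : ∏ j ∈ Finset.range 11, zetaR (j + 2) < 2.302 := by
  have bound : ∀ (j : ℕ) (c : ℝ), ∑ k ∈ Finset.range 20, 1 / (k + 1 : ℝ) ^ (j + 2) +
      1 / (20 + 1 : ℝ) ^ j * (1.64494 - ∑ k ∈ Finset.range 20, 1 / (k + 1 : ℝ) ^ 2) ≤ c →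
      zetaR (j + 2) ≤ c := by
    intro j c hc
    refine (zetaR_le 20 j).trans (le_trans ?_ hc)
    push_cast
    gcongr
    exact pi_sq_div_six_lt.le
  have hle : ∏ j ∈ Finset.range 11, zetaR (j + 2) ≤
      ∏ j ∈ Finset.range 11, (([1.64494, 1.2034, 1.0824, 1.03694, 1.01735, 1.00836, 1.00409,
        1.00202, 1.0011, 1.0005, 1.0003] : List ℝ).getD j 1) := by
    refine Finset.prod_le_prod (fun j _ => ?_) fun j hj => bound _ _ ?_
    · exact zero_le_one.trans (one_le_zetaR (by omega))
    · have := Finset.mem_range.1 hj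
      interval_cases j <;> norm_num [Finset.sum_range_succ]
  refine hle.trans_lt ?_
  norm_num [Finset.prod_range_succ]

lemma prod_zetaR_le (m : ℕ) :
    ∏ j ∈ Finset.range (m + 11), zetaR (j + 2) ≤ 2.304 * (1 - 3 / 2 ^ (m + 12)) := by
  induction m with
  | zero =>
    have := prod_zetaR_eleven_lt
    norm_num at this ⊢
    linarith
  | succ m ih =>
    have hz : zetaR (m + 11 + 2) ≤ 1 + 2.6 / 2 ^ (m + 13) := by
      refine (zetaR_le 1 (m + 11)).trans ?_
      have h := pi_sq_div_six_lt
      have : (1 : ℝ) / 2 ^ (m + 11) * (Real.pi ^ 2 / 6 - 1) ≤ 1 / 2 ^ (m + 11) * (2.6 / 4) := by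
        gcongr
        linarith
      calc _ = 1 + (1 : ℝ) / 2 ^ (m + 11) * (Real.pi ^ 2 / 6 - 1) := by norm_num
        _ ≤ 1 + (1 : ℝ) / 2 ^ (m + 11) * (2.6 / 4) := by gcongr
        _ = 1 + 2.6 / 2 ^ (m + 13) := by rw [pow_add _ m 13, pow_add _ m 11]; ring
    have ht : (0 : ℝ) < 1 / 2 ^ (m + 13) := by positivity
    rw [show m + 1 + 11 = m + 11 + 1 by ring, Finset.prod_range_succ]
    have h0 : 0 ≤ zetaR (m + 11 + 2) := zero_le_one.trans (one_le_zetaR (by omega))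
    have h3 : (0 : ℝ) ≤ 2.304 * (1 - 3 / 2 ^ (m + 12)) := by
      refine le_trans (Finset.prod_nonneg fun j _ => ?_) ih
      exact zero_le_one.trans (one_le_zetaR (by omega))
    refine (mul_le_mul ih hz h0 h3).trans ?_
    have e1 : (3 : ℝ) / 2 ^ (m + 12) = 6 * (1 / 2 ^ (m + 13)) := by
      rw [pow_add _ m 13, pow_add _ m 12]; ring
    have e2 : (3 : ℝ) / 2 ^ (m + 1 + 12) = 3 * (1 / 2 ^ (m + 13)) := by ring
    have e3 : (2.6 : ℝ) / 2 ^ (m + 13) = 2.6 * (1 / 2 ^ (m + 13)) := by ring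
    rw [e1, e2, e3]
    nlinarith

lemma prod_Icc_two_eq_prod_range {M : Type*} [CommMonoid M] (f : ℕ → M) (n : ℕ) :
    ∏ i ∈ Finset.Icc 2 (n + 1), f i = ∏ j ∈ Finset.range n, f (j + 2) := by
  rw [← Finset.Ico_add_one_right_eq_Icc, Finset.prod_Ico_eq_prod_range]
  simp [add_comm 2]

lemma le_prod_inv_zetaR (n : ℕ) : (0.434 : ℝ) ≤ ∏ i ∈ Finset.Icc 2 (n + 1), (zetaR i)⁻¹ := by
  have hreindex : ∏ i ∈ Finset.Icc 2 (n + 1), (zetaR i)⁻¹ =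
      (∏ j ∈ Finset.range n, zetaR (j + 2))⁻¹ := by
    rw [prod_Icc_two_eq_prod_range, Finset.prod_inv_distrib]
  have hmono : ∏ j ∈ Finset.range n, zetaR (j + 2) ≤ ∏ j ∈ Finset.range (n + 11), zetaR (j + 2) := by
    rw [Finset.prod_range_add]
    refine le_mul_of_one_le_right (Finset.prod_nonneg fun j _ => ?_) ?_
    · exact zero_le_one.trans (one_le_zetaR (by omega))
    · rw [← Finset.prod_const_one (s := Finset.range 11)]
      exact Finset.prod_le_prod (fun _ _ => zero_le_one) fun j _ => one_le_zetaR (by omega)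
  have hpos : 0 < ∏ j ∈ Finset.range n, zetaR (j + 2) :=
    Finset.prod_pos fun j _ => zero_lt_one.trans_le (one_le_zetaR (by omega))
  have h : ∏ j ∈ Finset.range n, zetaR (j + 2) ≤ 2.304 := by
    refine (hmono.trans (prod_zetaR_le n)).trans ?_
    have : (0 : ℝ) < 3 / 2 ^ (n + 12) := by positivity
    linarith
  rw [hreindex]
  refine le_trans ?_ (inv_anti₀ hpos h)
  norm_num

instance finite_addMonoidHom {G A : Type*} [AddZeroClass G] [AddZeroClass A] [Finite G]
    [Finite A] : Finite (G →+ A) :=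
  DFunLike.finite _

/-- If the images of `w` generate `G ⧸ ⟨x⟩` but `w` does not generate `G`, with `x` of prime order
`p`, then some character `G →+ ZMod p` kills `w` and takes the value `1` at `x`. -/
lemma exists_addMonoidHom_eq_one_of_closure_ne_top {G ι : Type*} [AddCommGroup G] {p : ℕ}
    [hp : Fact p.Prime] {x : G} (hx : addOrderOf x = p) {w : ι → G}
    (hQ : AddSubgroup.closure
      (Set.range fun i => (w i : G ⧸ AddSubgroup.zmultiples x)) = ⊤)
    (hw : AddSubgroup.closure (Set.range w) ≠ ⊤) :
    ∃ f : G →+ ZMod p, f x = 1 ∧ ∀ i, f (w i) = 0 := by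
  set H := AddSubgroup.closure (Set.range w) with hH
  have hsup : H ⊔ AddSubgroup.zmultiples x = ⊤ := by
    have h1 : H.map (QuotientAddGroup.mk' (AddSubgroup.zmultiples x)) = ⊤ := by
      rw [hH, AddMonoidHom.map_closure, ← Set.range_comp]
      exact hQ
    have h2 := congrArg (AddSubgroup.comap (QuotientAddGroup.mk' (AddSubgroup.zmultiples x))) h1
    rwa [AddSubgroup.comap_map_eq, QuotientAddGroup.ker_mk', AddSubgroup.comap_top] at h2
  have hxH : x ∉ H := fun h => hw (by
    rw [← hsup, eq_comm, sup_eq_left, AddSubgroup.zmultiples_le]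
    exact h)
  have hgen : ∀ y : G ⧸ H, y ∈ AddSubgroup.zmultiples (x : G ⧸ H) := by
    intro y
    induction y using QuotientAddGroup.induction_on with
    | H z =>
      have hz : z ∈ H ⊔ AddSubgroup.zmultiples x := hsup ▸ AddSubgroup.mem_top z
      obtain ⟨a, ha, b, ⟨m, rfl⟩, rfl⟩ := AddSubgroup.mem_sup.1 hz
      refine ⟨m, ?_⟩
      have : ((a : G) : G ⧸ H) = 0 := (QuotientAddGroup.eq_zero_iff a).2 ha
      simp [this]
  have hord : addOrderOf (x : G ⧸ H) = p := by
    refine addOrderOf_eq_prime ?_ ?_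
    · have := addOrderOf_nsmul_eq_zero x
      rw [hx] at this
      rw [← QuotientAddGroup.mk_nsmul, this, QuotientAddGroup.mk_zero]
    · rwa [Ne, QuotientAddGroup.eq_zero_iff]
  have hcard : Nat.card (G ⧸ H) = p := by
    rw [← hord, addOrderOf_eq_card_of_forall_mem_zmultiples hgen]
  let e : G ⧸ H ≃+ ZMod p := addEquivOfPrimeCardEq hcard (by simp)
  have he : e x ≠ 0 := by
    rwa [Ne, e.map_eq_zero_iff, QuotientAddGroup.eq_zero_iff]
  refine ⟨(AddMonoidHom.mulLeft (e x)⁻¹).comp (e.toAddMonoidHom.comp (QuotientAddGroup.mk' H)),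
    ?_, fun i => ?_⟩
  · simp [he]
  · have : ((w i : G) : G ⧸ H) = 0 :=
      (QuotientAddGroup.eq_zero_iff _).2 (AddSubgroup.subset_closure ⟨i, rfl⟩)
    simp [this]

/-- Each generating tuple of `G ⧸ ⟨x⟩` has `p ^ k` lifts to `G`, and at most as many of them fail to
generate `G` as there are characters `G →+ ZMod p` with value `1` at `x`. -/
lemma card_generating_quotient_mul_le {G : Type*} [AddCommGroup G] [Finite G] {p : ℕ}
    [hp : Fact p.Prime] {x : G} (hx : addOrderOf x = p) (k : ℕ) :
    Nat.card {v : Fin k → G ⧸ AddSubgroup.zmultiples x //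
        AddSubgroup.closure (Set.range v) = ⊤} * p ^ k ≤
      Nat.card {v : Fin k → G // AddSubgroup.closure (Set.range v) = ⊤} +
      Nat.card {v : Fin k → G ⧸ AddSubgroup.zmultiples x //
        AddSubgroup.closure (Set.range v) = ⊤} * Nat.card {f : G →+ ZMod p // f x = 1} := by
  classical
  set C := AddSubgroup.zmultiples x with hC
  have hcardC : Nat.card C = p := by rw [hC, Nat.card_zmultiples, hx]
  let lift : {v : Fin k → G ⧸ C // AddSubgroup.closure (Set.range v) = ⊤} × (Fin k → C) →
    Fin k → G := fun a i => (a.1.1 i).out + a.2 i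
  have hlift : ∀ a i, ((lift a i : G) : G ⧸ C) = a.1.1 i := by
    intro a i
    simp [lift]
  have hex : ∀ a, AddSubgroup.closure (Set.range (lift a)) ≠ ⊤ →
      ∃ f : G →+ ZMod p, f x = 1 ∧ ∀ i, f (lift a i) = 0 := fun a ha =>
    exists_addMonoidHom_eq_one_of_closure_ne_top hx (by simpa only [hlift] using a.1.2) ha
  choose F hF1 hF0 using hex
  let Φ : {v : Fin k → G ⧸ C // AddSubgroup.closure (Set.range v) = ⊤} × (Fin k → C) →
      {v : Fin k → G // AddSubgroup.closure (Set.range v) = ⊤} ⊕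
      ({v : Fin k → G ⧸ C // AddSubgroup.closure (Set.range v) = ⊤} ×
        {f : G →+ ZMod p // f x = 1}) := fun a =>
    if h : AddSubgroup.closure (Set.range (lift a)) = ⊤ then Sum.inl ⟨lift a, h⟩
    else Sum.inr (a.1, ⟨F a h, hF1 a h⟩)
  have hinj : Function.Injective Φ := by
    intro a b hab
    have hfst : a.1 = b.1 ∧ ∀ i, lift a i = lift b i := by
      by_cases ha : AddSubgroup.closure (Set.range (lift a)) = ⊤ <;>
        by_cases hb : AddSubgroup.closure (Set.range (lift b)) = ⊤ <;>
        simp only [Φ, ha, hb, dite_true, dite_false, reduceCtorEq, Sum.inl.injEq,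
          Sum.inr.injEq, Prod.mk.injEq, Subtype.mk.injEq] at hab
      · refine ⟨Subtype.ext (funext fun i => ?_), fun i => congrFun hab i⟩
        rw [← hlift a, ← hlift b, hab]
      · refine ⟨hab.1, fun i => ?_⟩
        have h1 := hF0 a ha i
        have h2 := hF0 b hb i
        rw [← hab.2] at h2
        have hmem : lift a i - lift b i ∈ C := by
          rw [← QuotientAddGroup.eq_zero_iff, QuotientAddGroup.mk_sub, hlift, hlift, hab.1,
            sub_self]
        obtain ⟨m, hm⟩ := hmem
        have h3 : F a ha (lift a i - lift b i) = 0 := by rw [map_sub, h1, h2, sub_self]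
        rw [← hm] at h3
        simp only [map_zsmul, hF1, zsmul_eq_mul, mul_one] at h3
        rw [ZMod.intCast_zmod_eq_zero_iff_dvd, ← hx, addOrderOf_dvd_iff_zsmul_eq_zero] at h3
        rw [← sub_eq_zero, ← hm]
        exact h3
    refine Prod.ext hfst.1 (funext fun i => Subtype.ext ?_)
    have := hfst.2 i
    simpa [lift, hfst.1] using this
  have := Nat.card_le_card_of_injective Φ hinj
  rwa [Nat.card_prod, Nat.card_sum, Nat.card_prod, Nat.card_fun, hcardC, Nat.card_fin] at this

lemma card_quotient_addMonoidHom_le {G A : Type*} [AddCommGroup G] [Finite G] [AddCommGroup A]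
    [Finite A] (C : AddSubgroup G) : Nat.card (G ⧸ C →+ A) ≤ Nat.card (G →+ A) :=
  Nat.card_le_card_of_injective (fun f => f.comp (QuotientAddGroup.mk' C)) fun _ _ h =>
    AddMonoidHom.cancel_right (QuotientAddGroup.mk'_surjective C) |>.1 h

lemma card_quotient_addMonoidHom_mul_le {G : Type*} [AddCommGroup G] [Finite G] {p : ℕ}
    [NeZero p] {x : G} (f₀ : G →+ ZMod p) (hf₀ : f₀ x = 1) :
    Nat.card (G ⧸ AddSubgroup.zmultiples x →+ ZMod p) * p ≤ Nat.card (G →+ ZMod p) := by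
  let Φ : (G ⧸ AddSubgroup.zmultiples x →+ ZMod p) × ZMod p → (G →+ ZMod p) := fun a =>
    a.1.comp (QuotientAddGroup.mk' _) + (AddMonoidHom.mulLeft a.2).comp f₀
  have hΦ : ∀ a, Φ a x = a.2 := fun a => by
    have : ((x : G) : G ⧸ AddSubgroup.zmultiples x) = 0 :=
      (QuotientAddGroup.eq_zero_iff _).2 (AddSubgroup.mem_zmultiples x)
    simp [Φ, hf₀, this]
  have hinj : Function.Injective Φ := by
    intro a b h
    have h2 : a.2 = b.2 := by rw [← hΦ a, ← hΦ b, h]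
    refine Prod.ext ?_ h2
    simp only [Φ, h2, add_left_inj] at h
    exact AddMonoidHom.cancel_right (QuotientAddGroup.mk'_surjective _) |>.1 h
  simpa using Nat.card_le_card_of_injective Φ hinj

lemma card_addMonoidHom_eq_one_mul_le {G : Type*} [AddCommGroup G] [Finite G] {p : ℕ}
    [NeZero p] {x : G} (f₀ : G →+ ZMod p) (hf₀ : f₀ x = 1) :
    Nat.card {f : G →+ ZMod p // f x = 1} * p ≤ Nat.card (G →+ ZMod p) := by
  let Φ : {f : G →+ ZMod p // f x = 1} × ZMod p → (G →+ ZMod p) := fun a =>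
    a.1.1 + (AddMonoidHom.mulLeft a.2).comp f₀
  have hΦ : ∀ a, Φ a x = 1 + a.2 := fun a => by simp [Φ, hf₀, a.1.2]
  have hinj : Function.Injective Φ := by
    intro a b h
    have h2 : a.2 = b.2 := by
      have := congrArg (· x) h
      simpa [hΦ] using this
    refine Prod.ext (Subtype.ext ?_) h2
    simpa only [Φ, h2, add_left_inj] using h
  simpa using Nat.card_le_card_of_injective Φ hinj

lemma card_addMonoidHom_le_of_closure_eq_top {G A : Type*} [AddCommGroup G] [AddCommGroup A]
    [Finite A] {n : ℕ} {g : Fin n → G} (hg : AddSubgroup.closure (Set.range g) = ⊤) :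
    Nat.card (G →+ A) ≤ Nat.card A ^ n := by
  have := Nat.card_le_card_of_injective (fun (f : G →+ A) (i : Fin n) => f (g i)) fun f f' h =>
    AddMonoidHom.eq_of_eqOn_dense hg (by rintro _ ⟨i, rfl⟩; exact congrFun h i)
  simpa [Nat.card_fun] using this

/-- Lower bound for the number of generating `k`-tuples of `G` in terms of upper bounds `r p` for
the `p`-ranks of `G`. -/
theorem card_pow_mul_prod_le_card_generating (k : ℕ) (S : Finset ℕ) (hS : ∀ p ∈ S, p.Prime)
    (N : ℕ) : ∀ (G : Type*) [AddCommGroup G] [Finite G] (r : ℕ → ℕ), Nat.card G = N →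
    (Nat.card G).primeFactors ⊆ S → (∀ p ∈ S, r p ≤ k) →
    (∀ p ∈ S, Nat.card (G →+ ZMod p) ≤ p ^ r p) →
    (Nat.card G : ℝ) ^ k * ∏ p ∈ S, ∏ j ∈ Finset.range (r p), (1 - (p : ℝ) ^ j / (p : ℝ) ^ k) ≤
      Nat.card {v : Fin k → G // AddSubgroup.closure (Set.range v) = ⊤} := by
  induction N using Nat.strong_induction_on with
  | _ N ih =>
  intro G _ _ r hN hGS hrk hr
  by_cases h1 : Nat.card G = 1
  · have hsub : Subsingleton G := (Nat.card_eq_one_iff_unique.1 h1).1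
    have hcount : Nat.card {v : Fin k → G // AddSubgroup.closure (Set.range v) = ⊤} = 1 := by
      have : Nonempty {v : Fin k → G // AddSubgroup.closure (Set.range v) = ⊤} :=
        ⟨⟨fun _ => 0, Subsingleton.elim _ _⟩⟩
      exact Nat.card_eq_one_iff_unique.2 ⟨inferInstance, this⟩
    rw [h1, hcount, Nat.cast_one, one_pow, one_mul]
    have hfac : ∀ p ∈ S, ∀ j ∈ Finset.range (r p), 0 ≤ 1 - (p : ℝ) ^ j / (p : ℝ) ^ k := by
      intro p hp j hj
      have hp1 : (1 : ℝ) ≤ p := mod_cast (hS p hp).one_le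
      have hjk : j ≤ k := (Finset.mem_range.1 hj).le.trans (hrk p hp)
      rw [sub_nonneg, div_le_one (by positivity)]
      exact pow_le_pow_right₀ hp1 hjk
    refine Finset.prod_le_one (fun p hp => Finset.prod_nonneg (hfac p hp)) fun p hp =>
      Finset.prod_le_one (hfac p hp) fun j _ => ?_
    rw [sub_le_self_iff]
    positivity
  obtain ⟨p, hp, hpG⟩ := Nat.exists_prime_and_dvd h1
  have : Fact p.Prime := ⟨hp⟩
  obtain ⟨x, hx⟩ := exists_prime_addOrderOf_dvd_card' p hpG
  have hG0 : Nat.card G ≠ 0 := Nat.card_pos.ne'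
  have hpS : p ∈ S := hGS (Nat.mem_primeFactors.2 ⟨hp, hpG, hG0⟩)
  set C := AddSubgroup.zmultiples x with hC
  have hcard : Nat.card G = Nat.card (G ⧸ C) * p := by
    rw [AddSubgroup.card_eq_card_quotient_mul_card_addSubgroup C, hC, Nat.card_zmultiples, hx]
  have hQpos : 0 < Nat.card (G ⧸ C) := Nat.card_pos
  have hlt : Nat.card (G ⧸ C) < N := by
    rw [← hN, hcard]
    exact lt_mul_of_one_lt_right hQpos hp.one_lt
  have hQS : (Nat.card (G ⧸ C)).primeFactors ⊆ S :=
    (Nat.primeFactors_mono (hcard ▸ Nat.dvd_mul_right _ _) hG0).trans hGS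
  have hQr : ∀ q ∈ S, Nat.card (G ⧸ C →+ ZMod q) ≤ q ^ r q := fun q hq => by
    have : NeZero q := ⟨(hS q hq).ne_zero⟩
    exact (card_quotient_addMonoidHom_le C).trans (hr q hq)
  have hp0 : (0 : ℝ) < p := mod_cast hp.pos
  have hkey := card_generating_quotient_mul_le hx k
  rw [← hC] at hkey
  set φQ := Nat.card {v : Fin k → G ⧸ C // AddSubgroup.closure (Set.range v) = ⊤}
  set φG := Nat.card {v : Fin k → G // AddSubgroup.closure (Set.range v) = ⊤}
  have hkey' : (φQ : ℝ) * p ^ k ≤ φG + φQ * Nat.card {f : G →+ ZMod p // f x = 1} := by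
    exact_mod_cast hkey
  have hcard' : (Nat.card G : ℝ) = Nat.card (G ⧸ C) * p := mod_cast hcard
  rcases isEmpty_or_nonempty {f : G →+ ZMod p // f x = 1} with hemp | ⟨⟨f₀, hf₀⟩⟩
  · have hI := ih _ hlt (G ⧸ C) r rfl hQS hrk hQr
    rw [Nat.card_of_isEmpty, Nat.cast_zero, mul_zero, add_zero] at hkey'
    refine le_trans ?_ hkey'
    rw [hcard', mul_pow, mul_right_comm]
    exact mul_le_mul_of_nonneg_right hI (by positivity)
  · have hQ1 := card_quotient_addMonoidHom_mul_le f₀ hf₀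
    have hR1 := card_addMonoidHom_eq_one_mul_le f₀ hf₀
    rw [← hC] at hQ1
    have hrp := hr p hpS
    obtain ⟨s, hs⟩ : ∃ s, r p = s + 1 := by
      refine Nat.exists_eq_succ_of_ne_zero fun h0 => ?_
      rw [h0, pow_zero] at hrp
      have : 0 < Nat.card (G ⧸ C →+ ZMod p) := Nat.card_pos
      have := hp.two_le
      nlinarith
    rw [hs, pow_succ] at hrp
    have hQ2 : Nat.card (G ⧸ C →+ ZMod p) ≤ p ^ s :=
      Nat.le_of_mul_le_mul_right (hQ1.trans hrp) hp.pos
    have hR2 : Nat.card {f : G →+ ZMod p // f x = 1} ≤ p ^ s :=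
      Nat.le_of_mul_le_mul_right (hR1.trans hrp) hp.pos
    have hI := ih _ hlt (G ⧸ C) (Function.update r p s) rfl hQS
      (fun q hq => by
        by_cases hqp : q = p
        · subst hqp
          have := hrk q hq
          simp only [Function.update_self]
          omega
        · simpa [hqp] using hrk q hq)
      (fun q hq => by
        by_cases hqp : q = p
        · subst hqp
          simpa using hQ2
        · simpa [hqp] using hQr q hq)
    have hprod : ∏ q ∈ S, ∏ j ∈ Finset.range (r q), (1 - (q : ℝ) ^ j / (q : ℝ) ^ k) =
        (∏ q ∈ S, ∏ j ∈ Finset.range (Function.update r p s q),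
          (1 - (q : ℝ) ^ j / (q : ℝ) ^ k)) * (1 - (p : ℝ) ^ s / (p : ℝ) ^ k) := by
      rw [← Finset.mul_prod_erase S _ hpS, ← Finset.mul_prod_erase S _ hpS, hs,
        Finset.prod_range_succ, Function.update_self, mul_right_comm]
      congr 2
      refine Finset.prod_congr rfl fun q hq => ?_
      rw [Function.update_of_ne (Finset.ne_of_mem_erase hq)]
    have hR3 : (Nat.card {f : G →+ ZMod p // f x = 1} : ℝ) ≤ (p : ℝ) ^ s := mod_cast hR2
    have hsk : (p : ℝ) ^ s ≤ (p : ℝ) ^ k :=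
      pow_le_pow_right₀ (mod_cast hp.one_le) (by have := hrk p hpS; omega)
    have hφQ : (0 : ℝ) ≤ φQ := by positivity
    calc _ = ((Nat.card (G ⧸ C) : ℝ) ^ k * ∏ q ∈ S,
          ∏ j ∈ Finset.range (Function.update r p s q), (1 - (q : ℝ) ^ j / (q : ℝ) ^ k)) *
          ((p : ℝ) ^ k - (p : ℝ) ^ s) := by
          rw [hprod, hcard', mul_pow]
          field_simp
      _ ≤ φQ * ((p : ℝ) ^ k - (p : ℝ) ^ s) :=
          mul_le_mul_of_nonneg_right hI (sub_nonneg.2 hsk)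
      _ ≤ φG := by nlinarith [mul_le_mul_of_nonneg_left hR3 hφQ]

/-- The tuples generating a group are those generating its additive copy. -/
lemma closure_range_eq_top_iff_additive {G ι : Type*} [Group G] (v : ι → G) :
    Subgroup.closure (Set.range v) = ⊤ ↔
      AddSubgroup.closure (Set.range fun i => Additive.ofMul (v i)) = ⊤ := by
  have hrange : (Set.range fun i => Additive.ofMul (v i)) = Additive.toMul ⁻¹' Set.range v := by
    ext y
    simp [Additive.ext_iff, Set.mem_range]
  rw [hrange, ← Subgroup.toAddSubgroup_closure, map_eq_top_iff]

theorem gen_finite_abelian_group (n : ℕ) (G : Type*) [CommGroup G] [Fintype G]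
    (hgen : ∃ g : Fin n → G, Subgroup.closure (Set.range g) = ⊤) :
    ((Nat.card {v : Fin (n + 1) → G // Subgroup.closure (Set.range v) = ⊤}) : ℝ) ≥
      (∏ i ∈ Finset.Icc 2 (n + 1), (zetaR i)⁻¹) * (Fintype.card G : ℝ) ^ (n + 1) ∧
    ((Nat.card {v : Fin (n + 1) → G // Subgroup.closure (Set.range v) = ⊤}) : ℝ) ≥
      0.434 * (Fintype.card G : ℝ) ^ (n + 1) := by
  obtain ⟨g, hg⟩ := hgen
  have hcount : Nat.card {v : Fin (n + 1) → G // Subgroup.closure (Set.range v) = ⊤} =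
      Nat.card {v : Fin (n + 1) → Additive G // AddSubgroup.closure (Set.range v) = ⊤} :=
    Nat.card_congr (Equiv.subtypeEquiv (Equiv.piCongrRight fun _ => Additive.ofMul)
      closure_range_eq_top_iff_additive)
  have hcard : Nat.card (Additive G) = Fintype.card G := by
    rw [← Nat.card_eq_fintype_card, Nat.card_congr Additive.toMul]
  set S := (Nat.card (Additive G)).primeFactors
  have hS : ∀ p ∈ S, p.Prime := fun p hp => Nat.prime_of_mem_primeFactors hp
  have hmain := card_pow_mul_prod_le_card_generating (n + 1) S hS _ (Additive G) (fun _ => n) rfl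
    subset_rfl (fun _ _ => n.le_succ) fun p hp => by
      have : NeZero p := ⟨(hS p hp).ne_zero⟩
      simpa using card_addMonoidHom_le_of_closure_eq_top (A := ZMod p)
        ((closure_range_eq_top_iff_additive g).1 hg)
  rw [← hcount, hcard] at hmain
  have hprod : ∏ i ∈ Finset.Icc 2 (n + 1), (zetaR i)⁻¹ ≤
      ∏ p ∈ S, ∏ j ∈ Finset.range n, (1 - (p : ℝ) ^ j / (p : ℝ) ^ (n + 1)) := by
    rw [Finset.prod_comm, ← Finset.prod_range_reflect, prod_Icc_two_eq_prod_range]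
    refine Finset.prod_le_prod (fun j _ => ?_) fun j hj => ?_
    · exact inv_nonneg.2 (zero_le_one.trans (one_le_zetaR (by omega)))
    · refine (inv_zetaR_le_prod (by omega) hS).trans_eq (Finset.prod_congr rfl fun p hp => ?_)
      have hp0 : (p : ℝ) ≠ 0 := mod_cast (hS p hp).ne_zero
      have hjn := Finset.mem_range.1 hj
      rw [show n + 1 = (n - 1 - j) + (j + 2) by omega, pow_add _ (n - 1 - j),
        ← div_div,
        div_self (pow_ne_zero _ hp0), one_div]
  have hzeta : (∏ i ∈ Finset.Icc 2 (n + 1), (zetaR i)⁻¹) * (Fintype.card G : ℝ) ^ (n + 1) ≤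
      Nat.card {v : Fin (n + 1) → G // Subgroup.closure (Set.range v) = ⊤} := by
    refine le_trans ?_ hmain
    rw [mul_comm]
    gcongr
  exact ⟨hzeta, (mul_le_mul_of_nonneg_right (le_prod_inv_zetaR n) (by positivity)).trans hzeta⟩
end
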